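/- Let G be a finite connected simple graph that is P_4-free (contains no induced subgraph isomorphic to the path on 4 vertices), i.e. a connected cograph. Then for every finite simple graph H, γ(G □ H) ≥ γ(G)·γ(H). -/

import Mathlib

open SimpleGraph Finset

/-- `S` is a dominating set of `G`: every vertex is in `S` or adjacent to a vertex of `S`. -/
def IsDomSet {V : Type*} (G : SimpleGraph V) (S : Finset V) : Prop :=
  ∀ v : V, v ∈ S ∨ ∃ u ∈ S, G.Adj u v

/-- The domination number of a finite graph. -/
noncomputable def domNum {V : Type*} [Fintype V] (G : SimpleGraph V) : ℕ :=
  sInf {n | ∃ S : Finset V, S.card = n ∧ IsDomSet G S}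

/-- `G` is `H`-free: `G` has no induced subgraph isomorphic to `H`,
equivalently there is no graph embedding of `H` into `G`. -/
def IsFree {V W : Type*} (G : SimpleGraph V) (H : SimpleGraph W) : Prop :=
  ¬ Nonempty (H ↪g G)

section Domination

variable {V W : Type*}

lemma domNum_le_card [Fintype V] {G : SimpleGraph V} {S : Finset V} (hS : IsDomSet G S) :
    domNum G ≤ S.card :=
  Nat.sInf_le ⟨S, rfl, hS⟩

lemma exists_isDomSet_card_eq_domNum [Fintype V] (G : SimpleGraph V) :
    ∃ S : Finset V, S.card = domNum G ∧ IsDomSet G S :=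
  Nat.sInf_mem (s := {n | ∃ S : Finset V, S.card = n ∧ IsDomSet G S})
    ⟨_, univ, rfl, fun v => Or.inl (mem_univ v)⟩

lemma IsFree.adj_of_path {G : SimpleGraph V} (hG : IsFree G (pathGraph 4)) {a b c d : V}
    (hab : G.Adj a b) (hbc : G.Adj b c) (hcd : G.Adj c d) :
    G.Adj a c ∨ G.Adj a d ∨ G.Adj b d := by
  by_contra! h
  obtain ⟨hac, had, hbd⟩ := h
  have hne_ac : a ≠ c := fun h => had (h ▸ hcd)
  have hne_ad : a ≠ d := fun h => hbd (h ▸ hab.symm)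
  have hne_bd : b ≠ d := fun h => had (h ▸ hab)
  refine hG ⟨⟨⟨![a, b, c, d], ?_⟩, ?_⟩⟩
  · intro i j hij
    fin_cases i <;> fin_cases j <;>
      simp_all [hab.ne, hab.ne', hbc.ne, hbc.ne', hcd.ne, hcd.ne', hne_ac.symm, hne_ad.symm,
        hne_bd.symm]
  · intro i j
    change G.Adj (![a, b, c, d] i) (![a, b, c, d] j) ↔ _
    fin_cases i <;> fin_cases j <;>
      simp [pathGraph_adj, hab, hbc, hcd, hac, had, hbd, hab.symm, hbc.symm, hcd.symm,
        G.adj_comm c a, G.adj_comm d a, G.adj_comm d b]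

/-- A connected `P₄`-free graph is dominated by at most two vertices. -/
lemma exists_dominating_pair [Fintype V] {G : SimpleGraph V} (hconn : G.Connected)
    (hP4 : IsFree G (pathGraph 4)) :
    ∃ u v : V, ∀ y, y = u ∨ y = v ∨ G.Adj u y ∨ G.Adj v y := by
  classical
  obtain ⟨v₀⟩ := hconn.nonempty
  by_cases hedge : ∃ u v, G.Adj u v
  swap
  · refine ⟨v₀, v₀, fun y => Or.inl ?_⟩
    by_contra hy
    have : Nontrivial V := ⟨y, v₀, hy⟩
    obtain ⟨w, hw⟩ := hconn.preconnected.exists_adj_of_nontrivial v₀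
    exact hedge ⟨_, _, hw⟩
  let N : V × V → Finset V := fun p => {y | G.Adj p.1 y ∨ G.Adj p.2 y}
  obtain ⟨⟨u, v⟩, huv, hmax⟩ :=
    Finset.exists_max_image ({p | G.Adj p.1 p.2} : Finset (V × V)) (fun p => (N p).card)
      (by obtain ⟨u, v, h⟩ := hedge; exact ⟨(u, v), by simpa using h⟩)
  simp only [mem_filter, mem_univ, true_and] at huv
  -- The union of neighbourhoods contains the endpoints, as they are adjacent.
  refine ⟨u, v, fun y => ?_⟩
  by_contra! hy
  obtain ⟨-, -, hyu, hyv⟩ := hy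
  obtain ⟨p⟩ := hconn.preconnected u y
  obtain ⟨e, -, hx, hw⟩ := p.exists_boundary_dart {z | G.Adj u z ∨ G.Adj v z}
    (Or.inr huv.symm) (by simp [hyu, hyv])
  obtain ⟨⟨x, w⟩, hxw⟩ := e
  simp only [Set.mem_ofPred_eq, not_or] at hx hw
  replace hxw : G.Adj x w := hxw
  have both : ∀ z, G.Adj z w → G.Adj u z ∨ G.Adj v z → G.Adj u z ∧ G.Adj v z := by
    rintro z hzw (h | h)
    · refine ⟨h, ?_⟩
      rcases hP4.adj_of_path huv.symm h hzw with h' | h' | h'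
      · exact h'
      · exact (hw.2 h').elim
      · exact (hw.1 h').elim
    · refine ⟨?_, h⟩
      rcases hP4.adj_of_path huv h hzw with h' | h' | h'
      · exact h'
      · exact (hw.1 h').elim
      · exact (hw.2 h').elim
  obtain ⟨hux, hvx⟩ := both x hxw hx
  have hlt : N (u, v) ⊂ N (u, x) := by
    refine Finset.ssubset_iff_subset_ne.2 ⟨fun z hz => ?_, fun heq => ?_⟩
    · simp only [N, mem_filter, mem_univ, true_and] at hz ⊢
      rcases hz with h | h
      · exact Or.inl h
      · by_cases hwz : G.Adj z w
        · exact Or.inl (both z hwz (Or.inr h)).1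
        · rcases hP4.adj_of_path hxw.symm hvx.symm h with h' | h' | h'
          · exact (hw.2 h'.symm).elim
          · exact (hwz h'.symm).elim
          · exact Or.inr h'
    · have hmem : w ∈ N (u, v) := heq ▸ by simp [N, hxw]
      simp [N, hw] at hmem
  exact (Finset.card_lt_card hlt).not_ge (hmax (u, x) (by simpa using hux))

lemma domNum_le_domNum_boxProd [Fintype V] [Fintype W] [Nonempty V] (G : SimpleGraph V)
    (H : SimpleGraph W) : domNum H ≤ domNum (G □ H) := by
  classical
  obtain ⟨D, hcard, hD⟩ := exists_isDomSet_card_eq_domNum (G □ H)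
  obtain ⟨v⟩ := ‹Nonempty V›
  rw [← hcard]
  refine (domNum_le_card (S := D.image Prod.snd) fun h => ?_).trans card_image_le
  rcases hD (v, h) with hv | ⟨⟨a, k⟩, hk, hadj⟩
  · exact Or.inl (mem_image_of_mem Prod.snd hv)
  · rcases boxProd_adj.1 hadj with ⟨-, h'⟩ | ⟨h', -⟩
    · exact Or.inl (mem_image.2 ⟨_, hk, h'⟩)
    · exact Or.inr ⟨k, mem_image.2 ⟨_, hk, rfl⟩, h'⟩

/-- If no vertex is adjacent to all others, the vertices split into two parts such that every
vertex has a non-neighbour in the part not containing it. -/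
lemma exists_set_forall_exists_not_adj [Finite V] {G : SimpleGraph V}
    (hG : ∀ v, ∃ w, w ≠ v ∧ ¬ G.Adj v w) :
    ∃ A : Set V, (∀ v ∈ A, ∃ w ∉ A, ¬ G.Adj v w) ∧ ∀ v ∉ A, ∃ w ∈ A, ¬ G.Adj v w := by
  obtain ⟨A, hA⟩ := (Set.toFinite {A : Set V | G.IsClique A}).exists_maximal
    ⟨∅, by simp⟩
  have hclique : G.IsClique A := hA.prop
  refine ⟨A, fun v hv => ?_, fun v hv => ?_⟩
  · obtain ⟨w, hwv, hw⟩ := hG v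
    exact ⟨w, fun hwA => hw (hclique hv hwA hwv.symm), hw⟩
  · by_contra! h
    have hins : G.IsClique (insert v A) := hclique.insert fun w hw _ => h w hw
    exact hv (hA.le_of_ge hins (Set.subset_insert v A) (Set.mem_insert v A))

open Classical in
/-- The vertices outside the closed neighbourhood of `P`. -/
noncomputable def undominated [Fintype W] (H : SimpleGraph W) (P : Finset W) : Finset W :=
  {h | ¬ (h ∈ P ∨ ∃ k ∈ P, H.Adj k h)}

lemma domNum_le_card_add_card_undominated [Fintype W] (H : SimpleGraph W) (P : Finset W) :
    domNum H ≤ P.card + (undominated H P).card := by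
  classical
  refine (domNum_le_card (S := P ∪ undominated H P) fun h => ?_).trans (card_union_le _ _)
  by_cases hh : h ∈ P ∨ ∃ k ∈ P, H.Adj k h
  · exact hh.imp (mem_union_left _) fun ⟨k, hk, hkh⟩ => ⟨k, mem_union_left _ hk, hkh⟩
  · exact Or.inl (mem_union_right _ (by simpa [undominated] using hh))

open Classical in
lemma card_image_add_card_undominated_le [Fintype W] [Nonempty V] {G : SimpleGraph V}
    {H : SimpleGraph W} {D : Finset (V × W)} (hD : IsDomSet (G □ H) D) {A : Set V}
    (hA : ∀ v ∉ A, ∃ w ∈ A, ¬ G.Adj v w) :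
    ({p ∈ D | p.1 ∉ A}.image Prod.snd).card +
        (undominated H ({p ∈ D | p.1 ∈ A}.image Prod.snd)).card ≤ {p ∈ D | p.1 ∉ A}.card := by
  set U := undominated H ({p ∈ D | p.1 ∈ A}.image Prod.snd)
  set E := {p ∈ D | p.1 ∉ A}
  obtain ⟨a₀, ha₀⟩ : A.Nonempty := by
    obtain ⟨v⟩ := ‹Nonempty V›
    by_cases hv : v ∈ A
    · exact ⟨v, hv⟩
    · exact (hA v hv).imp fun _ h => h.1
  have key : ∀ h ∈ U, ∀ a ∈ A, ∃ b, (b, h) ∈ E ∧ G.Adj b a := by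
    intro h hh a ha
    simp only [U, undominated, mem_filter, mem_univ, true_and, not_or, mem_image, not_exists,
      not_and] at hh
    obtain ⟨h₁, h₂⟩ := hh
    rcases hD (a, h) with hah | ⟨⟨b, k⟩, hbk, hadj⟩
    · exact (h₁ (a, h) ⟨hah, ha⟩ rfl).elim
    · rcases boxProd_adj.1 hadj with ⟨hba, hkh⟩ | ⟨hkh, hba⟩
      · obtain rfl : k = h := hkh
        by_cases hb : b ∈ A
        · exact (h₁ (b, k) ⟨hbk, hb⟩ rfl).elim
        · exact ⟨b, by simp [E, hbk, hb], hba⟩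
      · obtain rfl : b = a := hba
        exact (h₂ k ⟨(b, k), ⟨hbk, ha⟩, rfl⟩ hkh).elim
  have hsub : U ⊆ E.image Prod.snd := fun h hh => by
    obtain ⟨b, hb, -⟩ := key h hh a₀ ha₀
    exact mem_image.2 ⟨_, hb, rfl⟩
  have htwo : ∀ h ∈ U, 2 ≤ {p ∈ E | p.2 = h}.card := by
    intro h hh
    obtain ⟨b, hb, -⟩ := key h hh a₀ ha₀
    obtain ⟨a, ha, hba⟩ := hA b (mem_filter.1 hb).2
    obtain ⟨c, hc, hca⟩ := key h hh a ha
    refine one_lt_card.2 ⟨(b, h), by simp [hb], (c, h), by simp [hc], fun heq => ?_⟩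
    obtain rfl : b = c := congrArg Prod.fst heq
    exact hba hca
  calc (E.image Prod.snd).card + U.card
      = ∑ h ∈ E.image Prod.snd, (1 + if h ∈ U then 1 else 0) := by
        rw [sum_add_distrib, sum_ite_mem, inter_eq_right.2 hsub]; simp
    _ ≤ ∑ h ∈ E.image Prod.snd, {p ∈ E | p.2 = h}.card := by
        refine sum_le_sum fun h hh => ?_
        split_ifs with hU
        · exact htwo h hU
        · obtain ⟨p, hp, hph⟩ := mem_image.1 hh
          exact card_pos.2 ⟨p, mem_filter.2 ⟨hp, hph⟩⟩
    _ = E.card := (card_eq_sum_card_image Prod.snd E).symm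

lemma two_mul_domNum_le_domNum_boxProd [Fintype V] [Fintype W] [Nonempty V] {G : SimpleGraph V}
    (hG : ∀ v, ∃ w, w ≠ v ∧ ¬ G.Adj v w) (H : SimpleGraph W) :
    2 * domNum H ≤ domNum (G □ H) := by
  classical
  obtain ⟨D, hcard, hD⟩ := exists_isDomSet_card_eq_domNum (G □ H)
  obtain ⟨A, hA, hAc⟩ := exists_set_forall_exists_not_adj hG
  have h₁ := card_image_add_card_undominated_le hD hAc
  have h₂ := card_image_add_card_undominated_le hD (A := Aᶜ) (by simpa using hA)
  simp only [Set.mem_compl_iff, not_not] at h₂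
  have h₃ := domNum_le_card_add_card_undominated H ({p ∈ D | p.1 ∈ A}.image Prod.snd)
  have h₄ := domNum_le_card_add_card_undominated H ({p ∈ D | p.1 ∉ A}.image Prod.snd)
  have h₅ := card_filter_add_card_filter_not (s := D) (fun p : V × W => p.1 ∈ A)
  omega

end Domination

theorem stmt_1 {V W : Type*} [Fintype V] [Fintype W] (G : SimpleGraph V) (hconn : G.Connected)
    (hP4 : IsFree G (pathGraph 4)) (H : SimpleGraph W) :
    domNum G * domNum H ≤ domNum (G □ H) := by
  classical
  have := hconn.nonempty
  by_cases hG : ∀ v, ∃ w, w ≠ v ∧ ¬ G.Adj v w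
  · obtain ⟨u, v, huv⟩ := exists_dominating_pair hconn hP4
    have h2 : domNum G ≤ 2 :=
      (domNum_le_card (S := {u, v}) fun y => by simpa [or_assoc] using huv y).trans card_le_two
    exact (Nat.mul_le_mul_right _ h2).trans (two_mul_domNum_le_domNum_boxProd hG H)
  · push Not at hG
    obtain ⟨v, hv⟩ := hG
    have h1 : domNum G ≤ 1 := domNum_le_card (S := {v}) fun y => by
      simpa [or_iff_not_imp_left] using hv y
    exact (Nat.mul_le_mul_right _ h1).trans
      ((one_mul _).trans_le (domNum_le_domNum_boxProd G H))
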